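/- arXiv:math/0305253 — 2 statements merged into one kernel-verified Lean document; each statement's English description precedes it below -/
import Mathlib

section
/- For all natural numbers n, 3 · L_{2,n} = 2^{n+2} − (−1)^n (as integers). -/
/-- There exist indices `i, j` with `A (i+1, j) = A (i, j+1) = 1` (anti-diagonal pair). -/
def hasAnti (m n : ℕ) (A : Fin m × Fin n → Bool) : Prop :=
  ∃ i j, ∃ (hi : i + 1 < m) (hj : j + 1 < n),
    A (⟨i + 1, hi⟩, ⟨j, by omega⟩) = true ∧ A (⟨i, by omega⟩, ⟨j + 1, hj⟩) = true

/-- There exist indices `i, j` with `A (i, j) = A (i+1, j+1) = 1` (main-diagonal pair). -/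
def hasMain (m n : ℕ) (A : Fin m × Fin n → Bool) : Prop :=
  ∃ i j, ∃ (hi : i + 1 < m) (hj : j + 1 < n),
    A (⟨i, by omega⟩, ⟨j, by omega⟩) = true ∧ A (⟨i + 1, hi⟩, ⟨j + 1, hj⟩) = true

/-- There exist indices `i, j` with `A (i, j) = A (i, j+1) = 1` (horizontal pair). -/
def hasHoriz (m n : ℕ) (A : Fin m × Fin n → Bool) : Prop :=
  ∃ i j, ∃ (hi : i < m) (hj : j + 1 < n),
    A (⟨i, hi⟩, ⟨j, by omega⟩) = true ∧ A (⟨i, hi⟩, ⟨j + 1, hj⟩) = true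

/-- There exist indices `i, j` with `A (i, j) = A (i+1, j) = 1` (vertical pair). -/
def hasVert (m n : ℕ) (A : Fin m × Fin n → Bool) : Prop :=
  ∃ i j, ∃ (hi : i + 1 < m) (hj : j < n),
    A (⟨i, by omega⟩, ⟨j, hj⟩) = true ∧ A (⟨i + 1, hi⟩, ⟨j, hj⟩) = true

/-- `L m n`: the number of `m × n` binary matrices with no two 1's in adjacent cells in any
of the four directions (horizontal, vertical, or either diagonal). -/
noncomputable def L (m n : ℕ) : ℕ :=
  Nat.card {A : Fin m × Fin n → Bool //
    ¬ hasAnti m n A ∧ ¬ hasMain m n A ∧ ¬ hasHoriz m n A ∧ ¬ hasVert m n A}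

/-- Words of length `n` over `Option α` in which no two consecutive letters differ from `none`. -/
abbrev SparseWord (α : Type*) (n : ℕ) : Type _ :=
  {c : Fin n → Option α // ∀ j, ∀ hj : j + 1 < n,
    c ⟨j, by omega⟩ = none ∨ c ⟨j + 1, hj⟩ = none}

namespace SparseWord

variable {α : Type*} {n : ℕ}

/-- Prepend an empty letter. -/
def consNone (w : SparseWord α n) : SparseWord α (n + 1) :=
  ⟨Fin.cons none w.1, by
    rintro (_ | j) hj
    · exact Or.inl rfl
    · exact w.2 j (by omega)⟩

/-- Prepend a nonempty letter followed by an empty one. -/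
def consSome (a : α) (w : SparseWord α n) : SparseWord α (n + 2) :=
  ⟨Fin.cons (some a) (consNone w).1, by
    rintro (_ | j) hj
    · exact Or.inr rfl
    · exact (consNone w).2 j (by omega)⟩

/-- Remove the first letter. -/
def tail (w : SparseWord α (n + 1)) : SparseWord α n :=
  ⟨Fin.tail w.1, fun j hj => w.2 (j + 1) (by omega)⟩

theorem consNone_tail (w : SparseWord α (n + 1)) (h : w.1 0 = none) : consNone w.tail = w := by
  apply Subtype.ext
  obtain ⟨c, hc⟩ := w
  change Fin.cons none (Fin.tail c) = c
  rw [← show c 0 = none from h, Fin.cons_self_tail]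

theorem consSome_tail_tail (w : SparseWord α (n + 2)) {a : α} (h : w.1 0 = some a) :
    consSome a w.tail.tail = w := by
  have h1 : w.tail.1 0 = none := by
    rcases w.2 0 (by omega) with h' | h'
    · exact absurd (h.symm.trans h') (by simp)
    · exact h'
  apply Subtype.ext
  change Fin.cons (some a) (consNone w.tail.tail).1 = w.1
  rw [consNone_tail _ h1, ← h]
  exact Fin.cons_self_tail w.1

theorem bijective_cons :
    Function.Bijective (Sum.elim consNone (fun p : α × SparseWord α n => consSome p.1 p.2)) := by
  constructor
  · rintro (v | ⟨a, v⟩) (w | ⟨b, w⟩) h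
    · exact congrArg Sum.inl (congrArg tail h)
    · have : none = some b := congrFun (congrArg Subtype.val h) 0
      simp at this
    · have : some a = none := congrFun (congrArg Subtype.val h) 0
      simp at this
    · have hab : some a = some b := congrFun (congrArg Subtype.val h) 0
      have hvw : v = w := congrArg (fun u => u.tail.tail) h
      rw [Option.some.inj hab, hvw]
  · intro w
    cases h : w.1 0 with
    | none => exact ⟨Sum.inl w.tail, consNone_tail w h⟩
    | some a => exact ⟨Sum.inr (a, w.tail.tail), consSome_tail_tail w h⟩

theorem card_add_two [Finite α] :
    Nat.card (SparseWord α (n + 2)) =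
      Nat.card (SparseWord α (n + 1)) + Nat.card α * Nat.card (SparseWord α n) := by
  rw [← Nat.card_congr (Equiv.ofBijective _ (bijective_cons (α := α) (n := n))), Nat.card_sum,
    Nat.card_prod]

theorem card_one [Finite α] : Nat.card (SparseWord α 1) = Nat.card α + 1 := by
  rw [← Finite.card_option]
  exact Nat.card_congr
    ((Equiv.subtypeUnivEquiv fun c j hj => absurd hj (by omega)).trans (Equiv.funUnique _ _))

theorem three_mul_card_bool (n : ℕ) :
    3 * (Nat.card (SparseWord Bool n) : ℤ) = 2 ^ (n + 2) - (-1) ^ n := by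
  induction n using Nat.twoStepInduction with
  | zero => simp
  | one => simp [card_one]
  | more n ih₀ ih₁ =>
    rw [card_add_two, Nat.card_eq_fintype_card (α := Bool), Fintype.card_bool]
    push_cast
    linear_combination ih₁ + 2 * ih₀

end SparseWord

/-- The columns of a matrix with two rows and no two ones in adjacent cells form a sparse word:
a column is empty or has its only 1 in the first or in the second row. -/
def sparseWordEquiv (n : ℕ) :
    {A : Fin 2 × Fin n → Bool //
      ¬ hasAnti 2 n A ∧ ¬ hasMain 2 n A ∧ ¬ hasHoriz 2 n A ∧ ¬ hasVert 2 n A} ≃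
    SparseWord Bool n where
  toFun A := ⟨fun j => if A.1 (0, j) then some false else if A.1 (1, j) then some true else none, by
    obtain ⟨A, ha, hm, hh, -⟩ := A
    intro j hj
    have h₁ := fun h => ha ⟨0, j, one_lt_two, hj, h⟩
    have h₂ := fun h => hm ⟨0, j, one_lt_two, hj, h⟩
    have h₃ := fun h => hh ⟨0, j, two_pos, hj, h⟩
    have h₄ := fun h => hh ⟨1, j, one_lt_two, hj, h⟩
    simp only [zero_add, Fin.zero_eta, Fin.mk_one] at h₁ h₂ h₃ h₄
    grind⟩
  invFun w := ⟨fun p => w.1 p.2 == some (p.1 == 1), by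
    obtain ⟨c, hc⟩ := w
    refine ⟨?_, ?_, ?_, ?_⟩
    · rintro ⟨i, j, hi, hj, h, h'⟩
      have := hc j hj
      simp_all
    · rintro ⟨i, j, hi, hj, h, h'⟩
      have := hc j hj
      simp_all
    · rintro ⟨i, j, hi, hj, h, h'⟩
      have := hc j hj
      simp_all
    · rintro ⟨i, j, hi, hj, h, h'⟩
      obtain rfl : i = 0 := by omega
      simp_all⟩
  left_inv := by
    rintro ⟨A, -, -, -, hv⟩
    apply Subtype.ext
    funext ⟨i, j⟩
    have h := fun h => hv ⟨0, j, one_lt_two, j.2, h⟩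
    simp only [zero_add, Fin.zero_eta, Fin.mk_one] at h
    fin_cases i <;> cases h₀ : A (0, j) <;> cases h₁ : A (1, j) <;> simp_all
  right_inv := by
    rintro ⟨c, hc⟩
    apply Subtype.ext
    funext j
    rcases h : c j with _ | _ | _ <;> simp [h]

theorem L_two (n : ℕ) : 3 * (L 2 n : ℤ) = 2 ^ (n + 2) - (-1) ^ n := by
  rw [L, Nat.card_congr (sparseWordEquiv n), SparseWord.three_mul_card_bool]
end

section
/- Let (α_n)_{n≥0} be the integer sequence defined by α_0 = 1, α_1 = 4, α_2 = 8 and α_n = 2α_{n−1} + 2α_{n−2} − 2α_{n−3} for n ≥ 3 (equivalently, the sequence with ordinary generating function (1+2x−2x²)/(1−2x−2x²+2x³)). Then for every natural number n, M_{4,n} = α_n². -/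
/-- `M m n`: the number of `m × n` binary matrices with no two 1's diagonally adjacent,
i.e. the number of placements of mutually nonattacking pawns on an `m × n` board. -/
noncomputable def M (m n : ℕ) : ℕ :=
  Nat.card {A : Fin m × Fin n → Bool // ¬ hasAnti m n A ∧ ¬ hasMain m n A}

/-- Two consecutive columns `c`, `d` of height `m + 1` contain no diagonally adjacent 1's. -/
def ColumnsCompatible {m : ℕ} (c d : Fin (m + 1) → Bool) : Prop :=
  ∀ i : Fin m, ¬ (c i.succ = true ∧ d i.castSucc = true) ∧
    ¬ (c i.castSucc = true ∧ d i.succ = true)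

instance {m : ℕ} (c d : Fin (m + 1) → Bool) : Decidable (ColumnsCompatible c d) := by
  unfold ColumnsCompatible; infer_instance

/-- The total weight of the walks with `n` steps starting at `s`, each step from `s` to `t`
having weight `r s t`. -/
def walkWeight {S : Type*} [Fintype S] (r : S → S → ℤ) : ℕ → S → ℤ
  | 0, _ => 1
  | n + 1, s => ∑ t, r s t * walkWeight r n t

theorem sum_prod_cons_eq_walkWeight {S : Type*} [Fintype S] (r : S → S → ℤ) (n : ℕ) (s : S) :
    ∑ f : Fin n → S, ∏ i : Fin n,
      r (Fin.cons (α := fun _ => S) s f i.castSucc) (Fin.cons (α := fun _ => S) s f i.succ) =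
      walkWeight r n s := by
  induction n generalizing s with
  | zero => simp [walkWeight]
  | succ n ih =>
    rw [walkWeight, ← (Fin.consEquiv fun _ : Fin (n + 1) => S).sum_comp, Fintype.sum_prod_type]
    refine Finset.sum_congr rfl fun t _ => ?_
    rw [← ih t, Finset.mul_sum]
    refine Finset.sum_congr rfl fun f _ => ?_
    simp [Fin.prod_univ_succ, Fin.consEquiv]

theorem sum_prod_eq_sum_walkWeight {S : Type*} [Fintype S] (r : S → S → ℤ) (n : ℕ) :
    ∑ f : Fin (n + 1) → S, ∏ i : Fin n, r (f i.castSucc) (f i.succ) =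
      ∑ s, walkWeight r n s := by
  rw [← (Fin.consEquiv fun _ : Fin (n + 1) => S).sum_comp, Fintype.sum_prod_type]
  exact Finset.sum_congr rfl fun s _ => sum_prod_cons_eq_walkWeight r n s

theorem not_hasAnti_and_not_hasMain_iff {m n : ℕ} (A : Fin (m + 1) × Fin (n + 1) → Bool) :
    (¬ hasAnti (m + 1) (n + 1) A ∧ ¬ hasMain (m + 1) (n + 1) A) ↔
      ∀ j : Fin n, ColumnsCompatible (fun i => A (i, j.castSucc)) (fun i => A (i, j.succ)) := by
  constructor
  · rintro ⟨ha, hm⟩ j i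
    exact ⟨fun h => ha ⟨i, j, by omega, by omega, h⟩, fun h => hm ⟨i, j, by omega, by omega, h⟩⟩
  · intro h
    constructor
    · rintro ⟨i, j, hi, hj, hA⟩
      exact (h ⟨j, by omega⟩ ⟨i, by omega⟩).1 hA
    · rintro ⟨i, j, hi, hj, hA⟩
      exact (h ⟨j, by omega⟩ ⟨i, by omega⟩).2 hA

theorem M_succ_succ_eq_sum_walkWeight (m n : ℕ) :
    (M (m + 1) (n + 1) : ℤ) =
      ∑ c, walkWeight (fun c d : Fin (m + 1) → Bool => if ColumnsCompatible c d then 1 else 0)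
        n c := by
  have e : M (m + 1) (n + 1) = Nat.card {f : Fin (n + 1) → Fin (m + 1) → Bool //
      ∀ j : Fin n, ColumnsCompatible (f j.castSucc) (f j.succ)} :=
    Nat.card_congr (Equiv.subtypeEquiv
      (((Equiv.prodComm _ _).arrowCongr (Equiv.refl _)).trans (Equiv.curry _ _ _))
      fun A => not_hasAnti_and_not_hasMain_iff A)
  rw [e, ← sum_prod_eq_sum_walkWeight, Nat.card_eq_fintype_card, Fintype.card_subtype,
    Finset.card_filter]
  push_cast
  exact Finset.sum_congr rfl fun f _ => by simp [Finset.prod_ite_zero]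

theorem M_zero_right (m : ℕ) : M m 0 = 1 := by
  have h : ∀ A : Fin m × Fin 0 → Bool, ¬ hasAnti m 0 A ∧ ¬ hasMain m 0 A := fun A =>
    ⟨fun ⟨_, _, _, hj, _⟩ => by omega, fun ⟨_, _, _, hj, _⟩ => by omega⟩
  rw [M, Nat.card_congr (Equiv.subtypeUnivEquiv h)]
  simp

/-- The compatibility weight for the cells of one colour on a board of height four: a column is
recorded as the pair (border cell, inner cell). -/
def colourWeight (p q : Bool × Bool) : ℤ :=
  if ¬ (p.1 = true ∧ q.2 = true) ∧ ¬ (p.2 = true ∧ q.2 = true) ∧ ¬ (p.2 = true ∧ q.1 = true)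
  then 1 else 0

theorem columnsCompatible_four_weight (c d : Fin 4 → Bool) :
    (if ColumnsCompatible c d then 1 else 0 : ℤ) =
      colourWeight (c 0, c 2) (d 3, d 1) * colourWeight (c 3, c 1) (d 0, d 2) := by
  have h : ColumnsCompatible c d ↔
      (¬ (c 0 = true ∧ d 1 = true) ∧ ¬ (c 2 = true ∧ d 1 = true) ∧ ¬ (c 2 = true ∧ d 3 = true)) ∧
      (¬ (c 3 = true ∧ d 2 = true) ∧ ¬ (c 1 = true ∧ d 2 = true) ∧
        ¬ (c 1 = true ∧ d 0 = true)) := by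
    simp only [ColumnsCompatible, Fin.forall_fin_succ, IsEmpty.forall_iff]
    simp
    tauto
  simp only [h, colourWeight, ite_and, mul_ite, mul_one, mul_zero]
  split_ifs <;> rfl

theorem sum_column_mul (u v : Bool × Bool → ℤ) :
    ∑ c : Fin 4 → Bool, u (c 3, c 1) * v (c 0, c 2) = (∑ p, u p) * ∑ p, v p := by
  let e : (Fin 4 → Bool) ≃ (Bool × Bool) × (Bool × Bool) :=
    { toFun := fun c => ((c 3, c 1), (c 0, c 2))
      invFun := fun p => ![p.2.1, p.1.2, p.2.2, p.1.1]
      left_inv := fun c => by ext i; fin_cases i <;> rfl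
      right_inv := fun _ => rfl }
  rw [Fintype.sum_mul_sum, ← Fintype.sum_prod_type']
  exact e.sum_comp fun p => u p.1 * v p.2

theorem walkWeight_column_four (n : ℕ) (c : Fin 4 → Bool) :
    walkWeight (fun c d : Fin (3 + 1) → Bool => if ColumnsCompatible c d then 1 else 0) n c =
      walkWeight colourWeight n (c 0, c 2) * walkWeight colourWeight n (c 3, c 1) := by
  induction n generalizing c with
  | zero => simp [walkWeight]
  | succ n ih =>
    simp only [walkWeight, ih]
    rw [← sum_column_mul]
    refine Finset.sum_congr rfl fun d _ => ?_
    rw [columnsCompatible_four_weight]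
    ring

theorem sum_walkWeight_colourWeight (α : ℕ → ℤ) (h0 : α 0 = 1) (h1 : α 1 = 4) (h2 : α 2 = 8)
    (hrec : ∀ n, α (n + 3) = 2 * α (n + 2) + 2 * α (n + 1) - 2 * α n) (n : ℕ) :
    ∑ p, walkWeight colourWeight n p = α (n + 1) := by
  suffices h : walkWeight colourWeight n (false, false) = α n ∧
      ∑ p, walkWeight colourWeight n p = α (n + 1) ∧
      α (n + 2) = α (n + 1) + 3 * α n + walkWeight colourWeight n (true, false) from h.2.1
  induction n with
  | zero => simp [walkWeight, h0, h1, h2]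
  | succ n ih =>
    have hr := hrec n
    simp only [Fintype.sum_prod_type, Fintype.sum_bool, walkWeight, colourWeight] at ih ⊢
    norm_num at ih ⊢
    obtain ⟨h, h', h''⟩ := ih
    refine ⟨?_, ?_, ?_⟩ <;> linarith

theorem M_four_formula (α : ℕ → ℤ) (h0 : α 0 = 1) (h1 : α 1 = 4) (h2 : α 2 = 8)
    (hrec : ∀ n, α (n + 3) = 2 * α (n + 2) + 2 * α (n + 1) - 2 * α n) :
    ∀ n : ℕ, (M 4 n : ℤ) = α n ^ 2 := by
  rintro (_ | n)
  · simp [M_zero_right, h0]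
  · rw [M_succ_succ_eq_sum_walkWeight 3 n, ← sum_walkWeight_colourWeight α h0 h1 h2 hrec, sq,
      ← sum_column_mul]
    exact Finset.sum_congr rfl fun c _ => by rw [walkWeight_column_four, mul_comm]
end
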